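/- Fix κ ∈ (0,1), q ∈ [0,1], w > 0, and a finite Borel measure μ on [0,1] having a continuous, everywhere positive density with respect to Lebesgue measure. If κ > 1/2, then there exists a pure-strategy Nash equilibrium (f*,a*). -/

import Mathlib

open MeasureTheory Set

noncomputable section

/-- `μ` is a finite Borel measure on `[0,1]` with a continuous, everywhere positive
density with respect to Lebesgue measure. -/
def NiceDensity (μ : Measure ℝ) : Prop :=
  ∃ g : ℝ → ℝ, ContinuousOn g (Icc 0 1) ∧ (∀ p ∈ Icc (0:ℝ) 1, 0 < g p) ∧
    μ = (volume.restrict (Icc (0:ℝ) 1)).withDensity (fun p => ENNReal.ofReal (g p))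

/-- Total amount wagered by the diffuse players on Outcome 1. -/
def d1 (μ : Measure ℝ) (f : ℝ → ℝ × ℝ) : ℝ := ∫ p in Icc (0:ℝ) 1, (f p).1 ∂μ

/-- Total amount wagered by the diffuse players on Outcome 2. -/
def d2 (μ : Measure ℝ) (f : ℝ → ℝ × ℝ) : ℝ := ∫ p in Icc (0:ℝ) 1, (f p).2 ∂μ

/-- The implied probability of Outcome 1, `P^{f,a}`. -/
def impliedProb (μ : Measure ℝ) (f : ℝ → ℝ × ℝ) (a : ℝ × ℝ) : ℝ :=
  (d1 μ f + a.1) / (d1 μ f + d2 μ f + a.1 + a.2)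

/-- A feasible strategy profile for the diffuse players. -/
def FeasibleDiffuse (f : ℝ → ℝ × ℝ) : Prop :=
  Measurable f ∧ ∀ p ∈ Icc (0:ℝ) 1, 0 ≤ (f p).1 ∧ 0 ≤ (f p).2 ∧ (f p).1 + (f p).2 ≤ 1

/-- A feasible strategy profile for the atomic player. -/
def FeasibleAtomic (w : ℝ) (a : ℝ × ℝ) : Prop := 0 ≤ a.1 ∧ 0 ≤ a.2 ∧ a.1 + a.2 ≤ w

/-- The expected profit of a bettor who believes Outcome 1 occurs with probability `p`,
betting `b1` on Outcome 1 and `b2` on Outcome 2, when the implied probability of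
Outcome 1 is `P` (with the indicator conventions of the paper). -/
def payoff (κ P p b1 b2 : ℝ) : ℝ :=
  b1 * ((if P = 0 then 0 else κ * p / P) - 1) +
  b2 * ((if P = 1 then 0 else κ * (1 - p) / (1 - P)) - 1)

/-- A pure-strategy Nash equilibrium. -/
def IsEquilibrium (κ q w : ℝ) (μ : Measure ℝ) (f : ℝ → ℝ × ℝ) (a : ℝ × ℝ) : Prop :=
  FeasibleDiffuse f ∧ FeasibleAtomic w a ∧
  0 < d1 μ f + d2 μ f + a.1 + a.2 ∧
  (∀ p ∈ Icc (0:ℝ) 1,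
    payoff κ (impliedProb μ f a) p (f p).1 (f p).2 =
      sSup {x | ∃ b1 b2 : ℝ, 0 ≤ b1 ∧ 0 ≤ b2 ∧ b1 + b2 ≤ 1 ∧
        x = payoff κ (impliedProb μ f a) p b1 b2}) ∧
  payoff κ (impliedProb μ f a) q a.1 a.2 =
    sSup {x | ∃ b1 b2 : ℝ, 0 ≤ b1 ∧ 0 ≤ b2 ∧ b1 + b2 ≤ w ∧
      0 < d1 μ f + d2 μ f + b1 + b2 ∧
      x = payoff κ (impliedProb μ f (b1, b2)) q b1 b2}


/-- The best one-sided bet. -/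
def bestBet (w x m n : ℝ) : ℝ := min w (max 0 (Real.sqrt (x / (1 - x) * (m * n)) - m))

/-- Payoff of a one-sided bet. -/
def oneSided (x m n b : ℝ) : ℝ := b * (x * (m + n + b) / (m + b) - 1)

lemma bestBet_nonneg {w x m n : ℝ} (hw : 0 < w) : 0 ≤ bestBet w x m n :=
  le_min hw.le (le_max_left _ _)

lemma bestBet_le {w x m n : ℝ} : bestBet w x m n ≤ w := min_le_left _ _

lemma oneSided_diff {x m n a b s : ℝ} (hm : 0 < m) (hx1 : x < 1)
    (ha : 0 ≤ a) (hb : 0 ≤ b) (hs : s ^ 2 = x / (1 - x) * (m * n)) :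
    oneSided x m n a - oneSided x m n b =
      (1 - x) / ((m + a) * (m + b)) * ((b - a) * ((m + a) * (m + b) - s ^ 2)) := by
  rw [hs]
  unfold oneSided
  have h1 : m + a ≠ 0 := by positivity
  have h2 : m + b ≠ 0 := by positivity
  have h3 : 1 - x ≠ 0 := by linarith
  field_simp
  ring

lemma oneSided_le {w x m n b : ℝ} (hw : 0 < w) (hm : 0 < m) (hn : 0 < n) (hx0 : 0 ≤ x)
    (hx1 : x < 1) (hb : 0 ≤ b) (hbw : b ≤ w) :
    oneSided x m n b ≤ oneSided x m n (bestBet w x m n) := by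
  have h1x : 0 < 1 - x := by linarith
  have hpos : 0 ≤ x / (1 - x) * (m * n) := by positivity
  have ha := bestBet_nonneg (x := x) (m := m) (n := n) hw
  have hd := oneSided_diff (n := n) hm hx1 ha hb (Real.sq_sqrt hpos)
  have hs0 := Real.sqrt_nonneg (x / (1 - x) * (m * n))
  set s := Real.sqrt (x / (1 - x) * (m * n)) with hs
  have key : 0 ≤ (b - bestBet w x m n) * ((m + bestBet w x m n) * (m + b) - s ^ 2) := by
    unfold bestBet
    rw [← hs]
    rcases le_total (s - m) 0 with h | h
    · rw [max_eq_left h, min_eq_right hw.le]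
      apply mul_nonneg (by linarith)
      nlinarith
    · rw [max_eq_right h]
      rcases le_total w (s - m) with h' | h'
      · rw [min_eq_left h']
        apply mul_nonneg_of_nonpos_of_nonpos (by linarith)
        nlinarith
      · rw [min_eq_right h']
        have : (b - (s - m)) * ((m + (s - m)) * (m + b) - s ^ 2) = s * (b + m - s) ^ 2 := by ring
        rw [this]; positivity
  have : 0 ≤ oneSided x m n (bestBet w x m n) - oneSided x m n b := by
    rw [hd]; positivity
  linarith

lemma lt_of_bestBet_ne {w x m n : ℝ} (hw : 0 < w) (hm : 0 < m)
    (hx1 : x < 1) (h : bestBet w x m n ≠ 0) : (1 - x) * m < x * n := by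
  by_contra hc
  push Not at hc
  apply h
  have h1x : 0 < 1 - x := by linarith
  have : Real.sqrt (x / (1 - x) * (m * n)) ≤ m := by
    apply Real.sqrt_le_iff.2 ⟨hm.le, ?_⟩
    have : x / (1 - x) * (m * n) = (x * n) * m / (1 - x) := by field_simp
    rw [this, div_le_iff₀ h1x]
    nlinarith
  unfold bestBet
  rw [max_eq_left (by linarith), min_eq_right hw.le]

lemma bestBet_disjoint {w x y m n : ℝ} (hw : 0 < w) (hm : 0 < m) (hn : 0 < n)
    (hx0 : 0 ≤ x) (hy0 : 0 ≤ y) (hxy : x + y < 1) :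
    bestBet w x m n = 0 ∨ bestBet w y n m = 0 := by
  by_contra hc
  push Not at hc
  have h1 := lt_of_bestBet_ne hw hm (by linarith) hc.1
  have h2 := lt_of_bestBet_ne hw hn (by linarith) hc.2
  nlinarith

/-- Two-sided payoff. -/
def twoSided (x y m n b1 b2 : ℝ) : ℝ :=
  b1 * (x * (m + n + b1 + b2) / (m + b1) - 1) + b2 * (y * (m + n + b1 + b2) / (n + b2) - 1)

lemma twoSided_left (x y m n b : ℝ) : twoSided x y m n b 0 = oneSided x m n b := by
  unfold twoSided oneSided; simp

lemma twoSided_right (x y m n b : ℝ) : twoSided x y m n 0 b = oneSided y n m b := by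
  unfold twoSided oneSided; simp [add_comm m n]

lemma oneSided_zero (x m n : ℝ) : oneSided x m n 0 = 0 := by simp [oneSided]

lemma twoSided_shift {x y m n b1 b2 t : ℝ} (ht : t < 1) (h1 : 0 < m + b1) (h2 : 0 < n + b2) :
    twoSided x y m n (b1 - t * (m + b1)) (b2 - t * (n + b2)) =
      twoSided x y m n b1 b2 + t * (1 - x - y) * (m + n + b1 + b2) := by
  unfold twoSided
  have e1 : m + (b1 - t * (m + b1)) = (1 - t) * (m + b1) := by ring
  have e2 : n + (b2 - t * (n + b2)) = (1 - t) * (n + b2) := by ring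
  have e3 : m + n + (b1 - t * (m + b1)) + (b2 - t * (n + b2))
      = (1 - t) * (m + n + b1 + b2) := by ring
  rw [e1, e2, e3]
  have h3 : 1 - t ≠ 0 := by linarith
  have h1' := h1.ne'
  have h2' := h2.ne'
  field_simp
  ring

lemma twoSided_best {w x y m n b1 b2 : ℝ} (hw : 0 < w) (hm : 0 < m) (hn : 0 < n)
    (hx0 : 0 ≤ x) (hy0 : 0 ≤ y) (hxy : x + y < 1) (hb1 : 0 ≤ b1) (hb2 : 0 ≤ b2)
    (hb : b1 + b2 ≤ w) :
    twoSided x y m n b1 b2 ≤ twoSided x y m n (bestBet w x m n) (bestBet w y n m) := by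
  have L : ∀ b, 0 ≤ b → b ≤ w →
      oneSided x m n b ≤ oneSided x m n (bestBet w x m n) :=
    fun b h h' => oneSided_le hw hm hn hx0 (by linarith) h h'
  have R : ∀ b, 0 ≤ b → b ≤ w →
      oneSided y n m b ≤ oneSided y n m (bestBet w y n m) :=
    fun b h h' => oneSided_le hw hn hm hy0 (by linarith) h h'
  have L0 := L 0 le_rfl hw.le
  have R0 := R 0 le_rfl hw.le
  rw [oneSided_zero] at L0 R0
  have T1 : oneSided x m n (bestBet w x m n) ≤
      twoSided x y m n (bestBet w x m n) (bestBet w y n m) := by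
    rcases bestBet_disjoint hw hm hn hx0 hy0 hxy with h | h <;> rw [h]
    · rw [twoSided_right, oneSided_zero]; exact R0
    · rw [twoSided_left]
  have T2 : oneSided y n m (bestBet w y n m) ≤
      twoSided x y m n (bestBet w x m n) (bestBet w y n m) := by
    rcases bestBet_disjoint hw hm hn hx0 hy0 hxy with h | h <;> rw [h]
    · rw [twoSided_right]
    · rw [twoSided_left, oneSided_zero]; exact L0
  have hA : 0 < m + b1 := by linarith
  have hB : 0 < n + b2 := by linarith
  rcases le_total (b1 * (n + b2)) (b2 * (m + b1)) with h | h
  · have ht : b1 / (m + b1) < 1 := by rw [div_lt_one hA]; linarith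
    have ht0 : 0 ≤ b1 / (m + b1) := by positivity
    have e := twoSided_shift (x := x) (y := y) ht hA hB
    rw [div_mul_cancel₀ _ hA.ne', sub_self, twoSided_right] at e
    have hpos : 0 ≤ b1 / (m + b1) * (1 - x - y) * (m + n + b1 + b2) :=
      mul_nonneg (mul_nonneg ht0 (by linarith)) (by linarith)
    have h1 : b1 / (m + b1) * (n + b2) ≤ b2 := by
      rw [div_mul_eq_mul_div, div_le_iff₀ hA]; exact h
    have h2 : 0 ≤ b1 / (m + b1) * (n + b2) := by positivity
    have := R (b2 - b1 / (m + b1) * (n + b2)) (by linarith) (by linarith)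
    linarith
  · have ht : b2 / (n + b2) < 1 := by rw [div_lt_one hB]; linarith
    have ht0 : 0 ≤ b2 / (n + b2) := by positivity
    have e := twoSided_shift (x := x) (y := y) ht hA hB
    rw [div_mul_cancel₀ _ hB.ne', sub_self, twoSided_left] at e
    have hpos : 0 ≤ b2 / (n + b2) * (1 - x - y) * (m + n + b1 + b2) :=
      mul_nonneg (mul_nonneg ht0 (by linarith)) (by linarith)
    have h1 : b2 / (n + b2) * (m + b1) ≤ b1 := by
      rw [div_mul_eq_mul_div, div_le_iff₀ hB]; exact h
    have h2 : 0 ≤ b2 / (n + b2) * (m + b1) := by positivity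
    have := L (b1 - b2 / (n + b2) * (m + b1)) (by linarith) (by linarith)
    linarith

/-- Strategy of the diffuse players given thresholds. -/
def strat (s t : ℝ) (p : ℝ) : ℝ × ℝ := (if s ≤ p then 1 else 0, if p ≤ t then 1 else 0)

lemma strat_measurable (s t : ℝ) : Measurable (strat s t) := by
  apply Measurable.prodMk
  · exact Measurable.ite measurableSet_Ici measurable_const measurable_const
  · exact Measurable.ite measurableSet_Iic measurable_const measurable_const

lemma nice_finite {μ : Measure ℝ} (hμ : NiceDensity μ) : IsFiniteMeasure μ := by
  obtain ⟨g, hg, -, rfl⟩ := hμ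
  exact isFiniteMeasure_withDensity_ofReal (hg.integrableOn_Icc).2

lemma nice_ac {μ : Measure ℝ} (hμ : NiceDensity μ) : μ ≪ volume := by
  obtain ⟨g, hg, -, rfl⟩ := hμ
  exact (withDensity_absolutelyContinuous _ _).trans Measure.absolutelyContinuous_restrict

lemma nice_ac' {μ : Measure ℝ} (hμ : NiceDensity μ) : volume.restrict (Icc (0:ℝ) 1) ≪ μ := by
  obtain ⟨g, hg, hpos, rfl⟩ := hμ
  apply withDensity_absolutelyContinuous'
  · exact (hg.aemeasurable measurableSet_Icc).ennreal_ofReal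
  · filter_upwards [ae_restrict_mem measurableSet_Icc] with p hp
    simpa using hpos p hp

lemma nice_sing {μ : Measure ℝ} (hμ : NiceDensity μ) (t : ℝ) : μ {t} = 0 :=
  nice_ac hμ (by simp)

lemma nice_pos {μ : Measure ℝ} (hμ : NiceDensity μ) {s t : ℝ} (h0 : 0 ≤ s) (h1 : t ≤ 1)
    (h : s < t) : 0 < μ (Icc s t) := by
  rw [pos_iff_ne_zero]
  intro h'
  have := nice_ac' hμ h'
  rw [Measure.restrict_apply measurableSet_Icc,
    inter_eq_left.2 (Icc_subset_Icc h0 h1), Real.volume_Icc] at this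
  simp at this
  linarith

lemma d1_eq (μ : Measure ℝ) (s t : ℝ) :
    d1 μ (strat s t) = μ.real (Ici s ∩ Icc 0 1) := by
  unfold d1 strat
  have : (fun p : ℝ => (if s ≤ p then (1:ℝ) else 0)) = (Ici s).indicator 1 := by
    ext p; simp [indicator]
  simp only [this]
  rw [integral_indicator_one measurableSet_Ici, measureReal_restrict_apply measurableSet_Ici]

lemma d2_eq (μ : Measure ℝ) (s t : ℝ) :
    d2 μ (strat s t) = μ.real (Iic t ∩ Icc 0 1) := by
  unfold d2 strat
  have : (fun p : ℝ => (if p ≤ t then (1:ℝ) else 0)) = (Iic t).indicator 1 := by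
    ext p; simp [indicator]
  simp only [this]
  rw [integral_indicator_one measurableSet_Iic, measureReal_restrict_apply measurableSet_Iic]

lemma cont1 {μ : Measure ℝ} (hμ : NiceDensity μ) :
    Continuous fun s : ℝ => ∫ p in Icc (0:ℝ) 1, (if s ≤ p then (1:ℝ) else 0) ∂μ := by
  haveI := nice_finite hμ
  rw [continuous_iff_continuousAt]
  intro s0
  apply continuousAt_of_dominated (bound := fun _ => 1)
  · exact Filter.Eventually.of_forall fun s => (Measurable.ite measurableSet_Ici measurable_const
      measurable_const).aestronglyMeasurable
  · refine Filter.Eventually.of_forall fun s => Filter.Eventually.of_forall fun p => ?_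
    split_ifs <;> simp
  · exact integrable_const _
  · have : ∀ᵐ p ∂μ, p ≠ s0 := by
      rw [ae_iff]; simpa using nice_sing hμ s0
    filter_upwards [ae_restrict_of_ae this] with p hp
    rcases lt_or_gt_of_ne hp with h | h
    · apply (continuousAt_const (y := (0:ℝ))).congr
      filter_upwards [Ioi_mem_nhds h] with s hs
      simp only [mem_Ioi] at hs
      rw [if_neg (by linarith)]
    · apply (continuousAt_const (y := (1:ℝ))).congr
      filter_upwards [Iio_mem_nhds h] with s hs
      simp only [mem_Iio] at hs
      rw [if_pos (by linarith)]

lemma cont2 {μ : Measure ℝ} (hμ : NiceDensity μ) :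
    Continuous fun s : ℝ => ∫ p in Icc (0:ℝ) 1, (if p ≤ s then (1:ℝ) else 0) ∂μ := by
  haveI := nice_finite hμ
  rw [continuous_iff_continuousAt]
  intro s0
  apply continuousAt_of_dominated (bound := fun _ => 1)
  · exact Filter.Eventually.of_forall fun s => (Measurable.ite measurableSet_Iic measurable_const
      measurable_const).aestronglyMeasurable
  · refine Filter.Eventually.of_forall fun s => Filter.Eventually.of_forall fun p => ?_
    split_ifs <;> simp
  · exact integrable_const _
  · have : ∀ᵐ p ∂μ, p ≠ s0 := by
      rw [ae_iff]; simpa using nice_sing hμ s0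
    filter_upwards [ae_restrict_of_ae this] with p hp
    rcases lt_or_gt_of_ne hp with h | h
    · apply (continuousAt_const (y := (1:ℝ))).congr
      filter_upwards [Ioi_mem_nhds h] with s hs
      simp only [mem_Ioi] at hs
      rw [if_pos (by linarith)]
    · apply (continuousAt_const (y := (0:ℝ))).congr
      filter_upwards [Iio_mem_nhds h] with s hs
      simp only [mem_Iio] at hs
      rw [if_neg (by linarith)]

/-- Theorem (existence): if `κ > 1/2`, a pure-strategy Nash equilibrium exists. -/
theorem stmt_4 (κ q w : ℝ) (hκ : κ ∈ Ioo (0:ℝ) 1) (hq : q ∈ Icc (0:ℝ) 1) (hw : 0 < w)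
    (μ : Measure ℝ) (hμ : NiceDensity μ) (hκ2 : κ > 1/2) :
    ∃ (f : ℝ → ℝ × ℝ) (a : ℝ × ℝ), IsEquilibrium κ q w μ f a := by
  haveI := nice_finite hμ
  obtain ⟨hκ0, hκ1⟩ := hκ
  obtain ⟨hq0, hq1⟩ := hq
  let F : ℝ → ℝ → ℝ × ℝ := fun P => strat (P / κ) (1 - (1 - P) / κ)
  let m : ℝ → ℝ := fun P => d1 μ (F P)
  let n : ℝ → ℝ := fun P => d2 μ (F P)
  let x : ℝ := κ * q
  let y : ℝ := κ * (1 - q)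
  have hx0 : 0 ≤ x := mul_nonneg hκ0.le hq0
  have hy0 : 0 ≤ y := mul_nonneg hκ0.le (by linarith)
  have hxy : x + y < 1 := by simp only [x, y]; linarith
  have hmc : Continuous m := (cont1 hμ).comp (by fun_prop : Continuous fun P : ℝ => P / κ)
  have hnc : Continuous n :=
    (cont2 hμ).comp (by fun_prop : Continuous fun P : ℝ => 1 - (1 - P) / κ)
  have hm0 : ∀ P, 0 ≤ m P := fun P => by
    simp only [m, F, d1_eq]; positivity
  have hn0 : ∀ P, 0 ≤ n P := fun P => by
    simp only [n, F, d2_eq]; positivity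
  have hmpos : ∀ P, 0 < P → P < κ → 0 < m P := fun P h h' => by
    simp only [m, F, d1_eq]
    have h2 := nice_pos hμ (s := P / κ) (t := 1) (by positivity) le_rfl ((div_lt_one hκ0).2 h')
    refine (ENNReal.toReal_pos h2.ne' (measure_ne_top _ _)).trans_le
      (measureReal_mono (fun p hp => ⟨hp.1, le_trans (by positivity) hp.1, hp.2⟩))
  have hnpos : ∀ P, P < 1 → 1 - κ < P → 0 < n P := fun P h h' => by
    simp only [n, F, d2_eq]
    have e1 : (1 - P) / κ < 1 := by rw [div_lt_one hκ0]; linarith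
    have e2 : 0 < (1 - P) / κ := div_pos (by linarith) hκ0
    have h2 := nice_pos hμ (s := 0) (t := 1 - (1 - P) / κ) le_rfl (by linarith) (by linarith)
    refine (ENNReal.toReal_pos h2.ne' (measure_ne_top _ _)).trans_le
      (measureReal_mono (fun p hp => ⟨hp.2, hp.1, le_trans hp.2 (by linarith)⟩))
  have hmκ : m κ = 0 := by
    simp only [m, F, d1_eq, div_self hκ0.ne']
    have : μ (Ici 1 ∩ Icc 0 1) = 0 :=
      measure_mono_null (fun p hp => le_antisymm hp.2.2 hp.1) (nice_sing hμ 1)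
    simp [Measure.real, this]
  have hnκ : n (1 - κ) = 0 := by
    simp only [n, F, d2_eq, sub_sub_cancel, div_self hκ0.ne', sub_self]
    have : μ (Iic 0 ∩ Icc 0 1) = 0 :=
      measure_mono_null (fun p hp => le_antisymm hp.1 hp.2.1) (nice_sing hμ 0)
    simp [Measure.real, this]
  let a1 : ℝ → ℝ := fun P => bestBet w x (m P) (n P)
  let a2 : ℝ → ℝ := fun P => bestBet w y (n P) (m P)
  have ha1 : ∀ P, 0 ≤ a1 P := fun P => bestBet_nonneg hw
  have ha2 : ∀ P, 0 ≤ a2 P := fun P => bestBet_nonneg hw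
  have ha1c : Continuous a1 := by
    simp only [a1, bestBet]; fun_prop
  have ha2c : Continuous a2 := by
    simp only [a2, bestBet]; fun_prop
  -- fixed point
  let G : ℝ → ℝ := fun P => P * (m P + n P + a1 P + a2 P) - (m P + a1 P)
  have hGc : Continuous G := by simp only [G]; fun_prop
  have hmκ' := hmpos (1 - κ) (by linarith) (by linarith)
  have hnκ' := hnpos κ hκ1 (by linarith)
  have b1 : a1 (1 - κ) = 0 := by
    simp only [a1, bestBet, hnκ]
    simp [hw.le, hmκ'.le]
  have b2 : a2 (1 - κ) = 0 := by
    simp only [a2, bestBet, hnκ]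
    simp [hw.le]
  have b3 : a1 κ = 0 := by
    simp only [a1, bestBet, hmκ]
    simp [hw.le]
  have b4 : a2 κ = 0 := by
    simp only [a2, bestBet, hmκ]
    simp [hw.le, hnκ'.le]
  have hG1 : G (1 - κ) < 0 := by
    simp only [G, b1, b2, hnκ]; nlinarith
  have hG2 : 0 < G κ := by
    simp only [G, b3, b4, hmκ]; nlinarith
  obtain ⟨P, ⟨hP1, hP2⟩, hGP⟩ := intermediate_value_Ioo (by linarith : 1 - κ ≤ κ)
    hGc.continuousOn (show (0:ℝ) ∈ Ioo (G (1 - κ)) (G κ) from ⟨hG1, hG2⟩)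
  have hP0 : 0 < P := by linarith
  have hP1' : P < 1 := by linarith
  have hM : 0 < d1 μ (F P) := hmpos P hP0 hP2
  have hN : 0 < d2 μ (F P) := hnpos P hP1' hP1
  have hS : 0 < d1 μ (F P) + d2 μ (F P) + a1 P + a2 P := by linarith [ha1 P, ha2 P]
  have hprob : impliedProb μ (F P) (a1 P, a2 P) = P := by
    unfold impliedProb
    rw [div_eq_iff hS.ne']
    simp only [G, m, n] at hGP
    linarith
  have hpay : ∀ c1 c2 : ℝ, 0 ≤ c1 → 0 ≤ c2 →
      payoff κ (impliedProb μ (F P) (c1, c2)) q c1 c2 = twoSided x y (m P) (n P) c1 c2 := by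
    intro c1 c2 h1 h2
    have hT : 0 < d1 μ (F P) + d2 μ (F P) + c1 + c2 := by linarith
    have hA : 0 < d1 μ (F P) + c1 := by linarith
    have hB : 0 < d2 μ (F P) + c2 := by linarith
    have e : 1 - impliedProb μ (F P) (c1, c2) =
        (d2 μ (F P) + c2) / (d1 μ (F P) + d2 μ (F P) + c1 + c2) := by
      unfold impliedProb
      rw [eq_div_iff hT.ne', sub_mul, div_mul_cancel₀ _ hT.ne']; ring
    have e0 : impliedProb μ (F P) (c1, c2) ≠ 0 := (div_pos hA hT).ne'
    have e1 : impliedProb μ (F P) (c1, c2) ≠ 1 := by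
      intro h
      rw [h, sub_self] at e
      exact (div_pos hB hT).ne e
    unfold payoff twoSided
    rw [if_neg e0, if_neg e1, e]
    simp only [impliedProb, x, y, m, n]
    rw [div_div_eq_mul_div, div_div_eq_mul_div]
  have hdisj : a1 P = 0 ∨ a2 P = 0 := bestBet_disjoint hw hM hN hx0 hy0 hxy
  have hl1 : a1 P ≤ w := bestBet_le
  have hl2 : a2 P ≤ w := bestBet_le
  have hle : a1 P + a2 P ≤ w := by
    rcases hdisj with h | h <;> rw [h] <;> linarith
  have hthr : 1 - (1 - P) / κ < P / κ := by
    rw [sub_lt_iff_lt_add, ← add_div, lt_div_iff₀ hκ0]; linarith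
  refine ⟨F P, (a1 P, a2 P), ⟨strat_measurable _ _, ?_⟩, ⟨ha1 P, ha2 P, hle⟩, hS, ?_, ?_⟩
  · intro p _
    simp only [F, strat]
    split_ifs <;> norm_num
    linarith
  · intro p _
    rw [hprob]
    symm
    apply IsGreatest.csSup_eq
    constructor
    · refine ⟨(F P p).1, (F P p).2, ?_, ?_, ?_, rfl⟩ <;> simp only [F, strat] <;>
        split_ifs <;> norm_num
      linarith
    · rintro z ⟨c1, c2, h1, h2, h3, rfl⟩
      unfold payoff
      rw [if_neg hP0.ne', if_neg hP1'.ne]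
      have k1 : P / κ ≤ p ↔ 0 ≤ κ * p / P - 1 := by
        rw [sub_nonneg, le_div_iff₀ hP0, div_le_iff₀ hκ0, one_mul, mul_comm]
      have k2 : p ≤ 1 - (1 - P) / κ ↔ 0 ≤ κ * (1 - p) / (1 - P) - 1 := by
        rw [sub_nonneg, le_div_iff₀ (by linarith), le_sub_comm, div_le_iff₀ hκ0, one_mul, mul_comm]
      have k3 : ¬ (P / κ ≤ p ∧ p ≤ 1 - (1 - P) / κ) := fun h => by linarith [h.1, h.2]
      simp only [F, strat, k1, k2] at k3 ⊢
      generalize κ * p / P - 1 = u at *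
      generalize κ * (1 - p) / (1 - P) - 1 = v at *
      split_ifs with g1 g2 g2
      · exact absurd ⟨g1, g2⟩ k3
      · push Not at g2; nlinarith
      · push Not at g1; nlinarith
      · push Not at g1 g2; nlinarith
  · symm
    apply IsGreatest.csSup_eq
    constructor
    · exact ⟨a1 P, a2 P, ha1 P, ha2 P, hle, hS, rfl⟩
    · rintro z ⟨c1, c2, h1, h2, h3, -, rfl⟩
      rw [hpay c1 c2 h1 h2]
      show _ ≤ payoff κ (impliedProb μ (F P) (a1 P, a2 P)) q (a1 P) (a2 P)
      rw [hpay _ _ (ha1 P) (ha2 P)]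
      exact twoSided_best hw hM hN hx0 hy0 hxy h1 h2 h3
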